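/- arXiv:2406.10947 — 2 statements merged into one kernel-verified Lean document; each statement's English description precedes it below -/
import Mathlib

section
/- For α,β ∈ ℂ with β ≠ 0, let C41^{α,β} be the compatible pre-Lie algebra on ℂ² with first multiplication e1·e1 = e1, e1·e2 = 2 e2, e2·e1 = (1/2) e1 + e2, e2·e2 = e2 and second multiplication e1∗e1 = α e1, e1∗e2 = β e1 + 2α e2, e2∗e1 = (2β + α/2) e1 + α e2, e2∗e2 = (β/2) e1 + (α + β) e2. Then for β ≠ 0 and β' ≠ 0, the algebras C41^{α,β} and C41^{α',β'} are isomorphic as compatible pre-Lie algebras if and only if (α',β') = (α,β) or (α',β') = (α + 4β, −β). -/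
open scoped BigOperators

/-- The underlying vector space `ℂ²`. -/
abbrev V2 : Type := Fin 2 → ℂ

/-- The first standard basis vector of `ℂ²`. -/
noncomputable def e1 : V2 := ![1, 0]

/-- The second standard basis vector of `ℂ²`. -/
noncomputable def e2 : V2 := ![0, 1]

/-- The bilinear multiplication on `ℂ²` with multiplication table `f`,
i.e. the product of the `i`-th and `j`-th basis vectors is `f i j`. -/
noncomputable def bil (f : Fin 2 → Fin 2 → V2) : V2 →ₗ[ℂ] V2 →ₗ[ℂ] V2 :=
  LinearMap.mk₂ ℂ (fun x y => ∑ i : Fin 2, ∑ j : Fin 2, (x i * y j) • f i j)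
    (fun x x' y => by
      simp only [Pi.add_apply, add_mul, add_smul, Finset.sum_add_distrib])
    (fun c x y => by
      simp only [Pi.smul_apply, smul_eq_mul, Finset.smul_sum, smul_smul]
      refine Finset.sum_congr rfl fun i _ => Finset.sum_congr rfl fun j _ => ?_
      congr 1
      ring)
    (fun x y y' => by
      simp only [Pi.add_apply, mul_add, add_smul, Finset.sum_add_distrib])
    (fun c x y => by
      simp only [Pi.smul_apply, smul_eq_mul, Finset.smul_sum, smul_smul]
      refine Finset.sum_congr rfl fun i _ => Finset.sum_congr rfl fun j _ => ?_
      congr 1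
      ring)

/-- A bilinear map is a pre-Lie multiplication if it satisfies the (right)
pre-Lie identity. -/
def IsPreLie {V : Type*} [AddCommGroup V] [Module ℂ V]
    (μ : V →ₗ[ℂ] V →ₗ[ℂ] V) : Prop :=
  ∀ x y z : V, μ (μ x y) z - μ x (μ y z) = μ (μ y x) z - μ y (μ x z)

/-- `(V, μ, ν)` is a compatible pre-Lie algebra: `μ`, `ν` and `μ + ν` are all
pre-Lie multiplications. -/
def IsCompatPreLie {V : Type*} [AddCommGroup V] [Module ℂ V]
    (μ ν : V →ₗ[ℂ] V →ₗ[ℂ] V) : Prop :=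
  IsPreLie μ ∧ IsPreLie ν ∧ IsPreLie (μ + ν)

/-- Isomorphism of the two-multiplication algebras `(ℂ², μ, ν)` and `(ℂ², μ', ν')`. -/
def CompatIso (μ ν μ' ν' : V2 →ₗ[ℂ] V2 →ₗ[ℂ] V2) : Prop :=
  ∃ φ : V2 ≃ₗ[ℂ] V2, (∀ x y : V2, φ (μ x y) = μ' (φ x) (φ y)) ∧
    (∀ x y : V2, φ (ν x y) = ν' (φ x) (φ y))

/-- `C01 : e1·e1 = e1 + e2, e2·e1 = e2`. -/
noncomputable def C01 : V2 →ₗ[ℂ] V2 →ₗ[ℂ] V2 := bil ![![e1 + e2, 0], ![e2, 0]]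

/-- `C02 : e1·e1 = e1 + e2, e1·e2 = e2`. -/
noncomputable def C02 : V2 →ₗ[ℂ] V2 →ₗ[ℂ] V2 := bil ![![e1 + e2, e2], ![0, 0]]

/-- `C03 : e1·e1 = e2`. -/
noncomputable def C03 : V2 →ₗ[ℂ] V2 →ₗ[ℂ] V2 := bil ![![e2, 0], ![0, 0]]

/-- `C04 : e2·e1 = e1`. -/
noncomputable def C04 : V2 →ₗ[ℂ] V2 →ₗ[ℂ] V2 := bil ![![0, 0], ![e1, 0]]

/-- `C05^α : e1·e1 = e1, e1·e2 = α e2`. -/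
noncomputable def C05 (α : ℂ) : V2 →ₗ[ℂ] V2 →ₗ[ℂ] V2 := bil ![![e1, α • e2], ![0, 0]]

/-- `C06^α : e1·e1 = e1, e1·e2 = α e2, e2·e1 = e2`. -/
noncomputable def C06 (α : ℂ) : V2 →ₗ[ℂ] V2 →ₗ[ℂ] V2 := bil ![![e1, α • e2], ![e2, 0]]

/-- `C07 : e1·e1 = e1, e2·e2 = e2`. -/
noncomputable def C07 : V2 →ₗ[ℂ] V2 →ₗ[ℂ] V2 := bil ![![e1, 0], ![0, e2]]

/-- `C08 : e1·e1 = e1, e1·e2 = 2 e2, e2·e1 = (1/2) e1 + e2, e2·e2 = e2`. -/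
noncomputable def C08 : V2 →ₗ[ℂ] V2 →ₗ[ℂ] V2 :=
  bil ![![e1, (2 : ℂ) • e2], ![(1 / 2 : ℂ) • e1 + e2, e2]]

/-- The second multiplication of `C09^{α,β}`: `e1∗e1 = α e1, e1∗e2 = β e2, e2∗e1 = α e2`. -/
noncomputable def C09s (α β : ℂ) : V2 →ₗ[ℂ] V2 →ₗ[ℂ] V2 :=
  bil ![![α • e1, β • e2], ![α • e2, 0]]

/-- The second multiplication of `C10^{α,β}`: `e1∗e1 = α e1 + β e2, e2∗e1 = α e2`. -/
noncomputable def C10s (α β : ℂ) : V2 →ₗ[ℂ] V2 →ₗ[ℂ] V2 :=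
  bil ![![α • e1 + β • e2, 0], ![α • e2, 0]]

/-- The second multiplication of `C11^{α,β}`: `e1∗e1 = α e1, e1∗e2 = β e2`. -/
noncomputable def C11s (α β : ℂ) : V2 →ₗ[ℂ] V2 →ₗ[ℂ] V2 :=
  bil ![![α • e1, β • e2], ![0, 0]]

/-- The second multiplication of `C12^{α,β}`: `e1∗e1 = α e1 + β e2, e1∗e2 = α e2`. -/
noncomputable def C12s (α β : ℂ) : V2 →ₗ[ℂ] V2 →ₗ[ℂ] V2 :=
  bil ![![α • e1 + β • e2, α • e2], ![0, 0]]

/-- The second multiplication of `C13^α`: `e1∗e1 = α e1, e1∗e2 = e2, e2∗e1 = α e2`. -/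
noncomputable def C13s (α : ℂ) : V2 →ₗ[ℂ] V2 →ₗ[ℂ] V2 :=
  bil ![![α • e1, e2], ![α • e2, 0]]

/-- The second multiplication of `C14^α`: `e1∗e1 = e1 + α e2, e2∗e1 = e2`. -/
noncomputable def C14s (α : ℂ) : V2 →ₗ[ℂ] V2 →ₗ[ℂ] V2 :=
  bil ![![e1 + α • e2, 0], ![e2, 0]]

/-- The second multiplication of `C15^α`: `e1∗e1 = α e2`. -/
noncomputable def C15s (α : ℂ) : V2 →ₗ[ℂ] V2 →ₗ[ℂ] V2 :=
  bil ![![α • e2, 0], ![0, 0]]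

/-- The second multiplication of `C16^α`: `e1∗e1 = e1, e1∗e2 = α e2`. -/
noncomputable def C16s (α : ℂ) : V2 →ₗ[ℂ] V2 →ₗ[ℂ] V2 :=
  bil ![![e1, α • e2], ![0, 0]]

/-- The second multiplication of `C17^α`: `e1∗e1 = e1 + α e2, e1∗e2 = e2`. -/
noncomputable def C17s (α : ℂ) : V2 →ₗ[ℂ] V2 →ₗ[ℂ] V2 :=
  bil ![![e1 + α • e2, e2], ![0, 0]]

/-- The second multiplication of `C18^α`: `e1∗e1 = α e2, e1∗e2 = e1, e2∗e1 = e1, e2∗e2 = e2`. -/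
noncomputable def C18s (α : ℂ) : V2 →ₗ[ℂ] V2 →ₗ[ℂ] V2 :=
  bil ![![α • e2, e1], ![e1, e2]]

/-- The second multiplication of `C19^α`: `e1∗e1 = α e2, e2∗e1 = e1, e2∗e2 = 2 e2`. -/
noncomputable def C19s (α : ℂ) : V2 →ₗ[ℂ] V2 →ₗ[ℂ] V2 :=
  bil ![![α • e2, 0], ![e1, (2 : ℂ) • e2]]

/-- The second multiplication of `C20^{α,β}`: `e2∗e1 = α e1, e2∗e2 = e1 + β e2`. -/
noncomputable def C20s (α β : ℂ) : V2 →ₗ[ℂ] V2 →ₗ[ℂ] V2 :=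
  bil ![![0, 0], ![α • e1, e1 + β • e2]]

/-- The second multiplication of `C21^{α,β}`: `e2∗e1 = α e1, e2∗e2 = β e2`. -/
noncomputable def C21s (α β : ℂ) : V2 →ₗ[ℂ] V2 →ₗ[ℂ] V2 :=
  bil ![![0, 0], ![α • e1, β • e2]]

/-- The second multiplication of `C22^{α,β}`: `e1∗e2 = α e1, e2∗e1 = β e1, e2∗e2 = e1 + α e2`. -/
noncomputable def C22s (α β : ℂ) : V2 →ₗ[ℂ] V2 →ₗ[ℂ] V2 :=
  bil ![![0, α • e1], ![β • e1, e1 + α • e2]]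

/-- The second multiplication of `C23^{α,β}`: `e1∗e2 = α e1, e2∗e1 = β e1, e2∗e2 = α e2`. -/
noncomputable def C23s (α β : ℂ) : V2 →ₗ[ℂ] V2 →ₗ[ℂ] V2 :=
  bil ![![0, α • e1], ![β • e1, α • e2]]

/-- The second multiplication of `C24^{α,β,γ}`: `e1∗e1 = β e1 + e2, e1∗e2 = γ e2`. -/
noncomputable def C24s (β γ : ℂ) : V2 →ₗ[ℂ] V2 →ₗ[ℂ] V2 :=
  bil ![![β • e1 + e2, γ • e2], ![0, 0]]

/-- The second multiplication of `C25^{α,β,γ}`: `e1∗e1 = β e1, e1∗e2 = γ e2`. -/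
noncomputable def C25s (β γ : ℂ) : V2 →ₗ[ℂ] V2 →ₗ[ℂ] V2 :=
  bil ![![β • e1, γ • e2], ![0, 0]]

/-- The second multiplication of `C29^α`: `e1∗e1 = α e1, e2∗e2 = e2`. -/
noncomputable def C29s (α : ℂ) : V2 →ₗ[ℂ] V2 →ₗ[ℂ] V2 :=
  bil ![![α • e1, 0], ![0, e2]]

/-- The second multiplication of `C30^{α,β}`:
`e1∗e1 = α e1 + β e2, e1∗e2 = e1, e2∗e1 = e1, e2∗e2 = e2`. -/
noncomputable def C30s (α β : ℂ) : V2 →ₗ[ℂ] V2 →ₗ[ℂ] V2 :=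
  bil ![![α • e1 + β • e2, e1], ![e1, e2]]

/-- The second multiplication of `C31^{α,β,γ}`:
`e1∗e1 = β e1 + e2, e1∗e2 = γ e2, e2∗e1 = β e2`. -/
noncomputable def C31s (β γ : ℂ) : V2 →ₗ[ℂ] V2 →ₗ[ℂ] V2 :=
  bil ![![β • e1 + e2, γ • e2], ![β • e2, 0]]

/-- The second multiplication of `C32^{α,β,γ}`:
`e1∗e1 = β e1, e1∗e2 = γ e2, e2∗e1 = β e2`. -/
noncomputable def C32s (β γ : ℂ) : V2 →ₗ[ℂ] V2 →ₗ[ℂ] V2 :=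
  bil ![![β • e1, γ • e2], ![β • e2, 0]]

/-- The second multiplication of `C34^{α,β}`:
`e1∗e1 = α e1, e1∗e2 = α e2, e2∗e1 = α e2, e2∗e2 = e1 + β e2`. -/
noncomputable def C34s (α β : ℂ) : V2 →ₗ[ℂ] V2 →ₗ[ℂ] V2 :=
  bil ![![α • e1, α • e2], ![α • e2, e1 + β • e2]]

/-- The second multiplication of `C35^α`:
`e1∗e1 = α e1, e1∗e2 = α e2, e2∗e1 = α e2, e2∗e2 = e2`. -/
noncomputable def C35s (α : ℂ) : V2 →ₗ[ℂ] V2 →ₗ[ℂ] V2 :=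
  bil ![![α • e1, α • e2], ![α • e2, e2]]

/-- The second multiplication of `C38^{α,β,γ}`:
`e1∗e1 = (γ+β−α) e1 − β e2, e1∗e2 = α e1 + β e2, e2∗e1 = α e1 + β e2, e2∗e2 = −α e1 + γ e2`. -/
noncomputable def C38s (α β γ : ℂ) : V2 →ₗ[ℂ] V2 →ₗ[ℂ] V2 :=
  bil ![![(γ + β - α) • e1 - β • e2, α • e1 + β • e2],
        ![α • e1 + β • e2, (-α) • e1 + γ • e2]]

/-- The second multiplication of `C39^{α,β}`: `e1∗e1 = α e1, e2∗e2 = β e2`. -/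
noncomputable def C39s (α β : ℂ) : V2 →ₗ[ℂ] V2 →ₗ[ℂ] V2 :=
  bil ![![α • e1, 0], ![0, β • e2]]

/-- The second multiplication of `C40^{α,β,γ}`:
`e1∗e1 = α e1 + β e2, e1∗e2 = 2α e2, e2∗e1 = γ e1 + α e2, e2∗e2 = 2γ e2`. -/
noncomputable def C40s (α β γ : ℂ) : V2 →ₗ[ℂ] V2 →ₗ[ℂ] V2 :=
  bil ![![α • e1 + β • e2, (2 * α) • e2], ![γ • e1 + α • e2, (2 * γ) • e2]]

/-- The second multiplication of `C41^{α,β}`: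
`e1∗e1 = α e1, e1∗e2 = β e1 + 2α e2, e2∗e1 = (2β + α/2) e1 + α e2,
e2∗e2 = (β/2) e1 + (α+β) e2`. -/
noncomputable def C41s (α β : ℂ) : V2 →ₗ[ℂ] V2 →ₗ[ℂ] V2 :=
  bil ![![α • e1, β • e1 + (2 * α) • e2],
        ![(2 * β + α / 2) • e1 + α • e2, (β / 2) • e1 + (α + β) • e2]]

theorem C08_apply (x y : V2) :
    C08 x y = ![x 0 * y 0 + x 1 * y 0 / 2, 2 * (x 0 * y 1) + x 1 * y 0 + x 1 * y 1] := by
  ext i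
  fin_cases i <;> simp [C08, bil, e1, e2] <;> ring

theorem C41s_apply (α β : ℂ) (x y : V2) :
    C41s α β x y =
      ![α * (x 0 * y 0) + β * (x 0 * y 1) + (2 * β + α / 2) * (x 1 * y 0)
          + β / 2 * (x 1 * y 1),
        2 * α * (x 0 * y 1) + α * (x 1 * y 0) + (α + β) * (x 1 * y 1)] := by
  ext i
  fin_cases i <;> simp [C41s, bil, e1, e2] <;> ring

theorem C08_e1_e1 : C08 e1 e1 = e1 := by
  ext i
  fin_cases i <;> simp [C08_apply, e1]

theorem C08_e1_e2 : C08 e1 e2 = (2 : ℂ) • e2 := by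
  ext i
  fin_cases i <;> simp [C08_apply, e1, e2]

theorem C08_e2_e2 : C08 e2 e2 = e2 := by
  ext i
  fin_cases i <;> simp [C08_apply, e2]

theorem C41s_e1_e2 (α β : ℂ) : C41s α β e1 e2 = β • e1 + (2 * α) • e2 := by
  ext i
  fin_cases i <;> simp [C41s_apply, e1, e2]

/-- The nonzero idempotents of `C08` are `e1`, `e2` and `-e1 + 4 e2`. -/
theorem C08_idempotent {x : V2} (hx : x ≠ 0) (h : C08 x x = x) :
    x = e1 ∨ x = e2 ∨ x = ![-1, 4] := by
  obtain ⟨a, b, rfl⟩ : ∃ a b, x = ![a, b] := ⟨x 0, x 1, by ext i; fin_cases i <;> rfl⟩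
  have h0 : a * a + b * a / 2 = a := by simpa [C08_apply] using congrFun h 0
  have h1 : 2 * (a * b) + b * a + b * b = b := by simpa [C08_apply] using congrFun h 1
  by_cases ha : a = 0
  · subst ha
    have hb : b ≠ 0 := by
      rintro rfl
      exact hx (by ext i; fin_cases i <;> rfl)
    have : b = 1 := mul_left_cancel₀ hb (by linear_combination h1)
    exact Or.inr (Or.inl (by rw [this, e2]))
  · have hab : a = 1 - b / 2 := mul_left_cancel₀ ha (by linear_combination h0)
    by_cases hb : b = 0
    · exact Or.inl (by simp [hab, hb, e1])
    · have hb' : 3 * a + b = 1 := mul_left_cancel₀ hb (by linear_combination h1)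
      have h4 : b = 4 := by linear_combination (-2 : ℂ) * hb' + 6 * hab
      exact Or.inr (Or.inr (by rw [hab, h4]; norm_num))

/-- An injective linear endomorphism of `C08` preserving the products fixes `e2`, and sends `e1`
to `e1` or `-e1 + 4 e2`. -/
theorem C08_hom_apply_basis (φ : V2 →ₗ[ℂ] V2) (hinj : Function.Injective φ)
    (h : ∀ x y, φ (C08 x y) = C08 (φ x) (φ y)) :
    φ e2 = e2 ∧ (φ e1 = e1 ∨ φ e1 = ![-1, 4]) := by
  have h1 : C08 (φ e1) (φ e1) = φ e1 := by rw [← h, C08_e1_e1]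
  have h2 : C08 (φ e2) (φ e2) = φ e2 := by rw [← h, C08_e2_e2]
  have h12 : C08 (φ e1) (φ e2) = (2 : ℂ) • φ e2 := by rw [← h, C08_e1_e2, map_smul]
  have n1 : φ e1 ≠ 0 := (map_ne_zero_iff φ hinj).2 fun h0 => by simpa [e1] using congrFun h0 0
  have n2 : φ e2 ≠ 0 := (map_ne_zero_iff φ hinj).2 fun h0 => by simpa [e2] using congrFun h0 1
  have h12' : _ ∧ _ := ⟨congrFun h12 0, congrFun h12 1⟩
  revert h12'
  rcases C08_idempotent n1 h1 with p | p | p <;>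
    rcases C08_idempotent n2 h2 with q | q | q <;>
    rw [p, q, C08_apply] <;>
    norm_num [e1, e2]

/-- The involutive automorphism `e1 ↦ -e1 + 4 e2`, `e2 ↦ e2` of `C08`. -/
noncomputable def C08Involution : V2 ≃ₗ[ℂ] V2 :=
  LinearEquiv.ofInvolutive
    { toFun := fun x => ![-x 0, 4 * x 0 + x 1]
      map_add' := fun x y => by
        ext i
        fin_cases i <;> simp <;> ring
      map_smul' := fun c x => by
        ext i
        fin_cases i <;> simp
        ring }
    fun x => by
      ext i
      fin_cases i <;> simp

theorem C08Involution_apply (x : V2) : C08Involution x = ![-x 0, 4 * x 0 + x 1] := rfl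

/-- For `β ≠ 0`, `β' ≠ 0`: `C41^{α,β} ≅ C41^{α',β'}` iff `(α',β') = (α,β)` or
`(α',β') = (α + 4β, −β)`. -/
theorem C41_iso_iff (α β α' β' : ℂ) (hβ : β ≠ 0) (hβ' : β' ≠ 0) :
    CompatIso C08 (C41s α β) C08 (C41s α' β') ↔
      ((α', β') = (α, β) ∨ (α', β') = (α + 4 * β, -β)) := by
  constructor
  · rintro ⟨φ, hμ, hν⟩
    have h := hν e1 e2
    rw [C41s_e1_e2, map_add, map_smul, map_smul] at h
    obtain ⟨h2, h1 | h1⟩ := C08_hom_apply_basis φ.toLinearMap φ.injective hμ <;>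
      simp only [LinearEquiv.coe_coe] at h1 h2 <;>
      rw [h1, h2, C41s_apply] at h <;>
      have h0 := congrFun h 0 <;>
      have h1 := congrFun h 1 <;>
      simp [e1, e2] at h0 h1
    · exact Or.inl (by rw [h0, h1])
    · have hb : β' = -β := by linear_combination -h0
      refine Or.inr (Prod.ext ?_ hb)
      linear_combination (-1 / 2 : ℂ) * h1 - 2 * hb
  · rintro (h | h) <;> obtain ⟨rfl, rfl⟩ := Prod.mk.inj h
    · exact ⟨LinearEquiv.refl ℂ V2, fun _ _ => rfl, fun _ _ => rfl⟩
    · refine ⟨C08Involution, fun x y => ?_, fun x y => ?_⟩ <;>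
        ext i <;> fin_cases i <;>
        simp [C08Involution_apply, C08_apply, C41s_apply] <;> ring
end

section
/- Fix α ∈ ℂ. For t ∈ ℂ with t ≠ 0, let μ be the bilinear multiplication on ℂ² with e1·e1 = e1, e2·e2 = e2, let ν_t be the bilinear multiplication with e1∗e1 = α e1, e2∗e2 = t⁻¹ e2 (the second multiplication of C39^{α,1/t}), and let φ_t : ℂ² → ℂ² be the linear map with φ_t(e1) = e1, φ_t(e2) = t e2. Then for all x, y ∈ ℂ², as t → 0 (through nonzero values), φ_t⁻¹(μ(φ_t(x), φ_t(y))) tends to μ'(x,y) and φ_t⁻¹(ν_t(φ_t(x), φ_t(y))) tends to ν'(x,y), where μ' is the bilinear multiplication with μ'(e1,e1) = e1 and ν' is the bilinear multiplication with ν'(e1,e1) = α e1, ν'(e2,e2) = e2, all other products of basis vectors being zero. Hence C39^{α,1/t} degenerates to the compatible pre-Lie algebra C29^α = (ℂ², μ', ν'). -/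
open scoped BigOperators

open Filter Topology

theorem C39s_apply (α β : ℂ) (x y : V2) :
    C39s α β x y = ![α * (x 0 * y 0), β * (x 1 * y 1)] := by
  ext i
  fin_cases i <;> simp [C39s, bil, e1, e2, Fin.sum_univ_two, mul_comm]

theorem C07_eq_C39s : C07 = C39s 1 1 := by
  simp [C07, C39s]

theorem C05_zero_eq_C39s : C05 0 = C39s 1 0 := by
  simp [C05, C39s]

theorem C29s_eq_C39s (α : ℂ) : C29s α = C39s α 1 := by
  simp [C29s, C39s]

theorem apply_eq_of_basis {t : ℂ} {φ : V2 ≃ₗ[ℂ] V2} (h₁ : φ e1 = e1) (h₂ : φ e2 = t • e2)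
    (x : V2) : φ x = ![x 0, t * x 1] := by
  have hx : x = x 0 • e1 + x 1 • e2 := by
    ext i
    fin_cases i <;> simp [e1, e2]
  conv_lhs => rw [hx]
  rw [map_add, map_smul, map_smul, h₁, h₂]
  ext i
  fin_cases i <;> simp [e1, e2, mul_comm]

/-- Rescaling `e2` by `t` turns the second multiplication of `C39^{α,β}` into that of
`C39^{α,tβ}`. -/
theorem C39s_transport {t : ℂ} {φ : V2 ≃ₗ[ℂ] V2} (h₁ : φ e1 = e1) (h₂ : φ e2 = t • e2)
    (α β : ℂ) (x y : V2) : φ.symm (C39s α β (φ x) (φ y)) = C39s α (t * β) x y := by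
  rw [LinearEquiv.symm_apply_eq]
  simp only [apply_eq_of_basis h₁ h₂, C39s_apply]
  ext i
  fin_cases i
  · simp
  · simp
    ring

/-- The degeneration `C39^{α,1/t} → C29^α` along the basis change
`φ_t(e1) = e1, φ_t(e2) = t e2`: the transported multiplications tend to the
multiplications of `C29^α`, namely `e1·e1 = e1` (that is, `C05^0`) and
`e1∗e1 = α e1, e2∗e2 = e2`. -/
theorem C39_degenerates_to_C29 (α : ℂ) (φ : ℂ → (V2 ≃ₗ[ℂ] V2))
    (hφ : ∀ t : ℂ, t ≠ 0 → φ t e1 = e1 ∧ φ t e2 = t • e2)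
    (x y : V2) :
    Tendsto (fun t : ℂ => (φ t).symm (C07 (φ t x) (φ t y)))
        (nhdsWithin 0 {0}ᶜ) (nhds (C05 0 x y)) ∧
      Tendsto (fun t : ℂ => (φ t).symm (C39s α t⁻¹ (φ t x) (φ t y)))
        (nhdsWithin 0 {0}ᶜ) (nhds (C29s α x y)) := by
  rw [C07_eq_C39s, C05_zero_eq_C39s, C29s_eq_C39s]
  constructor
  · have hcont : Continuous fun t : ℂ => C39s 1 t x y := by
      simp only [C39s_apply]
      fun_prop
    refine ((hcont.tendsto 0).mono_left nhdsWithin_le_nhds).congr' ?_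
    filter_upwards [self_mem_nhdsWithin] with t ht
    rw [C39s_transport (hφ t ht).1 (hφ t ht).2, mul_one]
  · refine tendsto_const_nhds.congr' ?_
    filter_upwards [self_mem_nhdsWithin] with t ht
    rw [C39s_transport (hφ t ht).1 (hφ t ht).2, mul_inv_cancel₀ ht]
end
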